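/- arXiv:math/9806094 — 2 statements merged into one kernel-verified Lean document; each statement's English description precedes it below -/
import Mathlib

section
/- For every 0 < r < 1 and every integer m ≥ 0, the derivatives of the even iterates at 0 and π are (R_r^{2m})'(0) = (R_r^{2m})'(π) = ((1 − 9r²)/(1 − r²))^{m}. -/
open Real Filter

/-- The reflection map of the unit circle with light source at `(r,0)`. -/
noncomputable def R (r : ℝ) (φ : ℝ) : ℝ :=
  φ + π - 2 * arctan (r * sin φ / (1 - r * cos φ))

/-- The angle `φ_c ∈ (0,π)` with `cos φ_c = (1 − √(1+8r²))/(4r)`. -/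
noncomputable def φc (r : ℝ) : ℝ :=
  arccos ((1 - Real.sqrt (1 + 8 * r ^ 2)) / (4 * r))

/-- `x`-coordinate of the caustic of `R_r^n`. -/
noncomputable def xc (r : ℝ) (n : ℕ) (φ : ℝ) : ℝ :=
  (deriv ((R r)^[n]) φ * cos φ + cos ((R r)^[n] φ)) / (1 + deriv ((R r)^[n]) φ)

/-- `y`-coordinate of the caustic of `R_r^n`. -/
noncomputable def yc (r : ℝ) (n : ℕ) (φ : ℝ) : ℝ :=
  (deriv ((R r)^[n]) φ * sin φ + sin ((R r)^[n] φ)) / (1 + deriv ((R r)^[n]) φ)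

/-- The quantity `A_n(φ) = −(R_r^n)'(φ) + ((R_r^n)'(φ))³ + 2 (R_r^n)'''(φ)`. -/
noncomputable def A (r : ℝ) (n : ℕ) (φ : ℝ) : ℝ :=
  -(deriv ((R r)^[n]) φ) + (deriv ((R r)^[n]) φ) ^ 3 + 2 * iteratedDeriv 3 ((R r)^[n]) φ

theorem R_natCast_mul_pi (r : ℝ) (k : ℕ) : R r (k * π) = (k + 1 : ℕ) * π := by
  simp only [R, sin_nat_mul_pi, mul_zero, zero_div, arctan_zero]
  push_cast
  ring

theorem R_iterate_natCast_mul_pi (r : ℝ) (k n : ℕ) :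
    (R r)^[n] (k * π) = (k + n : ℕ) * π := by
  induction n with
  | zero => simp
  | succ n ih => rw [Function.iterate_succ_apply', ih, R_natCast_mul_pi, add_assoc]

theorem hasDerivAt_R {r φ : ℝ} (hs : sin φ = 0) (hc : 1 - r * cos φ ≠ 0) :
    HasDerivAt (R r) ((1 - 3 * (r * cos φ)) / (1 - r * cos φ)) φ := by
  have hq := ((hasDerivAt_sin φ).const_mul r).div
    (((hasDerivAt_cos φ).const_mul r).const_sub 1) hc
  refine (((hasDerivAt_id φ).add_const π).sub (hq.arctan.const_mul 2)).congr_deriv ?_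
  simp only [Pi.div_apply, hs]
  field_simp
  ring

theorem hasDerivAt_R_iterate_two {r : ℝ} (hr : 0 < r) (hr1 : r < 1) (k : ℕ) :
    HasDerivAt (R r ∘ R r) ((1 - 9 * r ^ 2) / (1 - r ^ 2)) (k * π) := by
  have hm : 1 - r ≠ 0 := by linarith
  have hp : 1 + r ≠ 0 := by linarith
  have hsq : 1 - r ^ 2 ≠ 0 := by nlinarith
  have hcos : cos ((k + 1 : ℕ) * π) = -cos (k * π) := by
    push_cast
    rw [add_mul, one_mul, cos_add_pi]
  have hcos_sq : cos (k * π) = 1 ∨ cos (k * π) = -1 := by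
    rw [cos_nat_mul_pi]
    exact neg_one_pow_eq_or ℝ k
  have h₁ : 1 - r * cos (k * π) ≠ 0 := by
    rcases hcos_sq with h | h <;> simpa [h]
  have h₂ : 1 - r * cos ((k + 1 : ℕ) * π) ≠ 0 := by
    rw [hcos]
    rcases hcos_sq with h | h <;> simpa [h]
  have hd := hasDerivAt_R (sin_nat_mul_pi (k + 1)) h₂
  rw [← R_natCast_mul_pi r k] at hd
  refine (hd.comp _ (hasDerivAt_R (sin_nat_mul_pi k) h₁)).congr_deriv ?_
  rw [R_natCast_mul_pi, hcos]
  rcases hcos_sq with h | h <;> rw [h] <;> simp only [mul_one, mul_neg, sub_neg_eq_add, neg_neg] <;>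
    field_simp <;> ring

theorem hasDerivAt_R_iterate_even {r : ℝ} (hr : 0 < r) (hr1 : r < 1) (k m : ℕ) :
    HasDerivAt ((R r)^[2 * m]) (((1 - 9 * r ^ 2) / (1 - r ^ 2)) ^ m) (k * π) := by
  induction m with
  | zero => simpa using hasDerivAt_id ((k : ℝ) * π)
  | succ m ih =>
    have hd := hasDerivAt_R_iterate_two hr hr1 (k + 2 * m)
    rw [← R_iterate_natCast_mul_pi r k (2 * m)] at hd
    rw [pow_succ', mul_add, mul_one, Function.iterate_succ', Function.iterate_succ']
    exact hd.comp _ ih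

theorem stmt_5 (r : ℝ) (hr : 0 < r) (hr1 : r < 1) (m : ℕ) :
    deriv ((R r)^[2 * m]) 0 = ((1 - 9 * r ^ 2) / (1 - r ^ 2)) ^ m ∧
    deriv ((R r)^[2 * m]) π = ((1 - 9 * r ^ 2) / (1 - r ^ 2)) ^ m := by
  constructor
  · simpa using (hasDerivAt_R_iterate_even hr hr1 0 m).deriv
  · simpa using (hasDerivAt_R_iterate_even hr hr1 1 m).deriv
end

section
/- For every 0 < r < 1/3 and every integer m ≥ 0 one has A_{2m+1}(0) > 0 and A_{2m+1}(π) > 0. (This is the nondegeneracy condition showing the caustic of every odd iterate R_r^{2m+1} has cusps at φ = 0 and φ = π.) -/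
open Real Filter

lemma one_sub_mul_cos_pos {r : ℝ} (hr : 0 < r) (hr1 : r < 1) (x : ℝ) : 0 < 1 - r * cos x := by
  nlinarith [cos_le_one x]

lemma one_sub_two_mul_cos_add_sq_pos {r : ℝ} (hr : 0 < r) (hr1 : r < 1) (x : ℝ) :
    0 < 1 - 2 * r * cos x + r ^ 2 := by
  nlinarith [cos_le_one x, sq_pos_of_pos (sub_pos.2 hr1)]

lemma hasDerivAt_R_s11 {r : ℝ} (hr : 0 < r) (hr1 : r < 1) (x : ℝ) :
    HasDerivAt (R r) (2 - (1 - r ^ 2) / (1 - 2 * r * cos x + r ^ 2)) x := by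
  have h1 := one_sub_mul_cos_pos hr hr1 x
  have h2 := one_sub_two_mul_cos_add_sq_pos hr hr1 x
  have hq := ((hasDerivAt_sin x).const_mul r).div
    (((hasDerivAt_cos x).const_mul r).const_sub 1) h1.ne'
  refine (((hasDerivAt_id x).add_const π).sub (hq.arctan.const_mul 2)).congr_deriv ?_
  have h3 : 1 + (r * sin x / (1 - r * cos x)) ^ 2
      = (1 - 2 * r * cos x + r ^ 2) / (1 - r * cos x) ^ 2 := by
    field_simp
    linear_combination r ^ 2 * sin_sq_add_cos_sq x
  simp only [Pi.div_apply]
  rw [h3]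
  field_simp
  linear_combination (2 * r ^ 2) * sin_sq_add_cos_sq x

lemma hasDerivAt_one_sub_two_mul_cos_add_sq (r x : ℝ) :
    HasDerivAt (fun y => 1 - 2 * r * cos y + r ^ 2) (2 * r * sin x) x :=
  ((((hasDerivAt_cos x).const_mul (2 * r)).const_sub 1).add_const (r ^ 2)).congr_deriv (by ring)

lemma hasDerivAt_deriv_R {r : ℝ} (hr : 0 < r) (hr1 : r < 1) (x : ℝ) :
    HasDerivAt (fun y => 2 - (1 - r ^ 2) / (1 - 2 * r * cos y + r ^ 2))
      ((1 - r ^ 2) * (2 * r * sin x) / (1 - 2 * r * cos x + r ^ 2) ^ 2) x := by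
  have h2 := one_sub_two_mul_cos_add_sq_pos hr hr1 x
  refine (((hasDerivAt_const x (1 - r ^ 2)).div
    (hasDerivAt_one_sub_two_mul_cos_add_sq r x) h2.ne').const_sub 2).congr_deriv ?_
  ring

lemma hasDerivAt_deriv_deriv_R {r : ℝ} (hr : 0 < r) (hr1 : r < 1) (x : ℝ) :
    HasDerivAt (fun y => (1 - r ^ 2) * (2 * r * sin y) / (1 - 2 * r * cos y + r ^ 2) ^ 2)
      ((1 - r ^ 2) * (2 * r * cos x) / (1 - 2 * r * cos x + r ^ 2) ^ 2
        - 2 * (1 - r ^ 2) * (2 * r * sin x) ^ 2 / (1 - 2 * r * cos x + r ^ 2) ^ 3) x := by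
  have h2 := one_sub_two_mul_cos_add_sq_pos hr hr1 x
  refine ((((hasDerivAt_sin x).const_mul (2 * r)).const_mul (1 - r ^ 2)).div
    ((hasDerivAt_one_sub_two_mul_cos_add_sq r x).pow 2) (pow_pos h2 2).ne').congr_deriv ?_
  simp only [Pi.pow_apply]
  generalize 1 - 2 * r * cos x + r ^ 2 = D at h2 ⊢
  field_simp
  ring

/-- `IsThreeJet f f₁ f₂ f₃` says that `f₁`, `f₂`, `f₃` are the first three derivatives of `f`. -/
structure IsThreeJet (f f₁ f₂ f₃ : ℝ → ℝ) : Prop where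
  first : ∀ x, HasDerivAt f (f₁ x) x
  second : ∀ x, HasDerivAt f₁ (f₂ x) x
  third : ∀ x, HasDerivAt f₂ (f₃ x) x

namespace IsThreeJet

variable {f f₁ f₂ f₃ g g₁ g₂ g₃ : ℝ → ℝ}

lemma deriv_eq (h : IsThreeJet f f₁ f₂ f₃) : deriv f = f₁ :=
  funext fun x => (h.first x).deriv

lemma iteratedDeriv_three_eq (h : IsThreeJet f f₁ f₂ f₃) : iteratedDeriv 3 f = f₃ := by
  rw [iteratedDeriv_succ, iteratedDeriv_succ, iteratedDeriv_one, h.deriv_eq,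
    funext fun x => (h.second x).deriv, funext fun x => (h.third x).deriv]

lemma comp (hg : IsThreeJet g g₁ g₂ g₃) (hf : IsThreeJet f f₁ f₂ f₃) :
    IsThreeJet (g ∘ f) (fun x => g₁ (f x) * f₁ x)
      (fun x => g₂ (f x) * f₁ x ^ 2 + g₁ (f x) * f₂ x)
      (fun x => g₃ (f x) * f₁ x ^ 3 + 3 * g₂ (f x) * f₁ x * f₂ x + g₁ (f x) * f₃ x) where
  first x := (hg.first (f x)).comp x (hf.first x)
  second x := by
    refine (((hg.second (f x)).comp x (hf.first x)).mul (hf.second x)).congr_deriv ?_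
    simp only [Function.comp_apply]
    ring
  third x := by
    refine ((((hg.third (f x)).comp x (hf.first x)).mul ((hf.second x).pow 2)).add
      (((hg.second (f x)).comp x (hf.first x)).mul (hf.third x))).congr_deriv ?_
    simp only [Function.comp_apply, Pi.pow_apply]
    ring

end IsThreeJet

lemma isThreeJet_R {r : ℝ} (hr : 0 < r) (hr1 : r < 1) :
    IsThreeJet (R r) (fun x => 2 - (1 - r ^ 2) / (1 - 2 * r * cos x + r ^ 2))
      (fun x => (1 - r ^ 2) * (2 * r * sin x) / (1 - 2 * r * cos x + r ^ 2) ^ 2)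
      (fun x => (1 - r ^ 2) * (2 * r * cos x) / (1 - 2 * r * cos x + r ^ 2) ^ 2
        - 2 * (1 - r ^ 2) * (2 * r * sin x) ^ 2 / (1 - 2 * r * cos x + r ^ 2) ^ 3) :=
  ⟨hasDerivAt_R_s11 hr hr1, hasDerivAt_deriv_R hr hr1, hasDerivAt_deriv_deriv_R hr hr1⟩

lemma sin_R_eq_zero {r x : ℝ} (hx : sin x = 0) : sin (R r x) = 0 := by
  simp [R, hx]

lemma deriv_R_pos {r : ℝ} (hr : 0 < r) (hr1 : r < 1 / 3) (x : ℝ) :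
    0 < 2 - (1 - r ^ 2) / (1 - 2 * r * cos x + r ^ 2) := by
  have h := one_sub_two_mul_cos_add_sq_pos hr (by linarith) x
  rw [sub_pos, div_lt_iff₀ h]
  nlinarith [cos_le_one x]

/-- At a zero of `sin`, the quantity `A_1` equals `24 r² / (1 - r cos x)²`, hence is positive. -/
lemma A_one_pos_of_sin_eq_zero {r x : ℝ} (hr : 0 < r) (hr1 : r < 1) (hx : sin x = 0) :
    0 < A r 1 x := by
  have h := one_sub_mul_cos_pos hr hr1 x
  have hc : cos x ^ 2 = 1 := by simpa [hx] using sin_sq_add_cos_sq x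
  have hD : 1 - 2 * r * cos x + r ^ 2 = (1 - r * cos x) ^ 2 := by
    linear_combination (-r ^ 2) * hc
  have hN : 1 - r ^ 2 = (1 - r * cos x) * (1 + r * cos x) := by
    linear_combination r ^ 2 * hc
  have hA : A r 1 x = 24 * (r * cos x) ^ 2 / (1 - r * cos x) ^ 2 := by
    have hj := isThreeJet_R hr hr1
    simp only [A, Function.iterate_one, hj.deriv_eq, hj.iteratedDeriv_three_eq]
    rw [hx, hD, hN]
    field_simp
    ring
  rw [hA, mul_pow, hc]
  positivity

/-- The chain rule for `A` along the orbit of a zero of `sin`: the second derivatives vanish there,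
and positivity of `A` propagates because all iterates are increasing. -/
lemma exists_isThreeJet_iterate_R {r x : ℝ} (hr : 0 < r) (hr1 : r < 1 / 3) (hx : sin x = 0)
    (n : ℕ) : ∃ f₁ f₂ f₃ : ℝ → ℝ, IsThreeJet ((R r)^[n + 1]) f₁ f₂ f₃ ∧
      sin ((R r)^[n + 1] x) = 0 ∧ 0 < f₁ x ∧ f₂ x = 0 ∧ 0 < -f₁ x + f₁ x ^ 3 + 2 * f₃ x := by
  have hr1' : r < 1 := by linarith
  have hR := isThreeJet_R hr hr1'
  have hA := fun y (hy : sin y = 0) => A_one_pos_of_sin_eq_zero hr hr1' hy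
  simp only [A, Function.iterate_one, hR.deriv_eq, hR.iteratedDeriv_three_eq] at hA
  induction n with
  | zero =>
    exact ⟨_, _, _, by simpa using hR, by simpa using sin_R_eq_zero hx, deriv_R_pos hr hr1 x,
      by simp [hx], hA x hx⟩
  | succ n ih =>
    obtain ⟨f₁, f₂, f₃, hf, hs, h1, h2, h3⟩ := ih
    refine ⟨_, _, _, by rw [Function.iterate_succ']; exact hR.comp hf, ?_, ?_, ?_, ?_⟩
    · rw [Function.iterate_succ_apply']
      exact sin_R_eq_zero hs
    · exact mul_pos (deriv_R_pos hr hr1 _) h1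
    · simp only [hs, h2]
      ring
    · have key := add_pos (mul_pos (pow_pos h1 3) (hA _ hs))
        (mul_pos (deriv_R_pos hr hr1 ((R r)^[n + 1] x)) h3)
      refine key.trans_eq ?_
      simp only [h2]
      ring

lemma A_succ_pos_of_sin_eq_zero {r x : ℝ} (hr : 0 < r) (hr1 : r < 1 / 3) (hx : sin x = 0)
    (n : ℕ) : 0 < A r (n + 1) x := by
  obtain ⟨f₁, f₂, f₃, hf, -, -, -, h⟩ := exists_isThreeJet_iterate_R hr hr1 hx n
  rwa [A, hf.deriv_eq, hf.iteratedDeriv_three_eq]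

theorem stmt_11 (r : ℝ) (hr : 0 < r) (hr1 : r < 1 / 3) (m : ℕ) :
    0 < A r (2 * m + 1) 0 ∧ 0 < A r (2 * m + 1) π :=
  ⟨A_succ_pos_of_sin_eq_zero hr hr1 sin_zero _, A_succ_pos_of_sin_eq_zero hr hr1 sin_pi _⟩
end
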